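/- arXiv:2605.04833 — 4 statements merged into one kernel-verified Lean document; each statement's English description precedes it below -/
import Mathlib

section
/- Let M, H > 0 with H > nM, and let x_1, …, x_n ∈ [−M, M] be real numbers; set x_{n+1} = H. Then the sample variance of (x_1, …, x_{n+1}) satisfies s²(x) ≤ (n/(n+1)²)(H + M)², and equality is attained when x_1 = ⋯ = x_n = −M. -/
/-- The sample variance of a tuple `y : Fin m → ℝ`:
`s²(y) = (1/m) ∑ i, (y i − ȳ)²` where `ȳ = (1/m) ∑ i, y i`. -/
noncomputable def sampleVar {m : ℕ} (y : Fin m → ℝ) : ℝ :=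
  (∑ i, (y i - (∑ j, y j) / m) ^ 2) / m

theorem sampleVar_snoc_aux (n : ℕ) (H : ℝ) (x : Fin n → ℝ) :
    sampleVar (Fin.snoc x H : Fin (n + 1) → ℝ) =
      (((n : ℝ) + 1) * (∑ i, x i ^ 2 + H ^ 2) - (∑ i, x i + H) ^ 2) / ((n : ℝ) + 1) ^ 2 := by
  have hn : (n : ℝ) + 1 ≠ 0 := by positivity
  have key : ∀ c : ℝ, ∑ i, (x i - c) ^ 2 = ∑ i, x i ^ 2 - 2 * c * ∑ i, x i + n * c ^ 2 := by
    intro c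
    have : ∀ i, (x i - c) ^ 2 = x i ^ 2 - 2 * c * x i + c ^ 2 := fun i => by ring
    simp [this, Finset.sum_add_distrib, Finset.sum_sub_distrib, Finset.mul_sum]
  unfold sampleVar
  simp only [Fin.sum_univ_castSucc, Fin.snoc_castSucc, Fin.snoc_last, Nat.cast_add, Nat.cast_one]
  rw [key]
  field_simp
  ring

/-- Let `M, H > 0` with `H > n·M`, let `x₁, …, xₙ ∈ [−M, M]` and set `x_{n+1} = H`.
Then the sample variance of `(x₁, …, x_{n+1})` satisfies
`s²(x) ≤ (n/(n+1)²)(H + M)²`, with equality when `x₁ = ⋯ = xₙ = −M`. -/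
theorem sampleVar_le_of_outlier_max (n : ℕ) (M H : ℝ) (hM : 0 < M) (hH : 0 < H)
    (hHn : (n : ℝ) * M < H) (x : Fin n → ℝ) (hx : ∀ i, x i ∈ Set.Icc (-M) M) :
    sampleVar (Fin.snoc x H) ≤ ((n : ℝ) / ((n : ℝ) + 1) ^ 2) * (H + M) ^ 2 ∧
      sampleVar (Fin.snoc (fun _ : Fin n => -M) H) =
        ((n : ℝ) / ((n : ℝ) + 1) ^ 2) * (H + M) ^ 2 := by
  have hn : (0 : ℝ) < (n : ℝ) + 1 := by positivity
  constructor
  · rw [sampleVar_snoc_aux, div_mul_eq_mul_div]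
    apply div_le_div_of_nonneg_right _ (by positivity)
    have hQ : ∑ i, x i ^ 2 ≤ n * M ^ 2 := by
      have : ∑ i, x i ^ 2 ≤ ∑ _i : Fin n, M ^ 2 :=
        Finset.sum_le_sum fun i _ => sq_le_sq' (hx i).1 (hx i).2
      simpa using this
    have hS : -(n * M) ≤ ∑ i, x i := by
      have : ∑ _i : Fin n, (-M) ≤ ∑ i, x i := Finset.sum_le_sum fun i _ => (hx i).1
      simpa using this
    have h1 := mul_le_mul_of_nonneg_left hQ hn.le
    have h2 : 0 ≤ (∑ i, x i + n * M) * (2 * H + ∑ i, x i - n * M) :=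
      mul_nonneg (by linarith) (by linarith)
    nlinarith [h1, h2]
  · rw [sampleVar_snoc_aux]
    simp only [Finset.sum_const, Finset.card_univ, Fintype.card_fin, nsmul_eq_mul]
    field_simp
    ring
end

section
/- Let x_1, …, x_{n+1} ∈ ℝ^p with ‖x_i‖ ≤ M for i = 1, …, n and ‖x_{n+1}‖ = H, where H ≥ M > 0. Set v = x_{n+1}/‖x_{n+1}‖. Then the projected sample variance along v satisfies s_v²(x) ≥ (n/(n+1)²)(H − M)². -/
open scoped RealInnerProductSpace

/-- The projected sample variance of `x₁, …, x_{n+1} ∈ ℝᵖ` along `w ∈ ℝᵖ`: the sample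
variance of the real numbers `⟨x₁, w⟩, …, ⟨x_{n+1}, w⟩`. -/
noncomputable def projVar {m p : ℕ} (x : Fin m → EuclideanSpace ℝ (Fin p))
    (w : EuclideanSpace ℝ (Fin p)) : ℝ :=
  sampleVar (fun i => ⟪x i, w⟫)

/-- Let `x₁, …, x_{n+1} ∈ ℝᵖ` with `‖xᵢ‖ ≤ M` for `i ≤ n` and `‖x_{n+1}‖ = H`, where
`H ≥ M > 0`. Set `v = x_{n+1}/‖x_{n+1}‖`. Then the projected sample variance along `v`
satisfies `s_v²(x) ≥ (n/(n+1)²)(H − M)²`. -/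
theorem projVar_along_outlier_ge (n p : ℕ) (M H : ℝ) (hM : 0 < M) (hHM : M ≤ H)
    (x : Fin (n + 1) → EuclideanSpace ℝ (Fin p))
    (hx : ∀ i : Fin n, ‖x i.castSucc‖ ≤ M) (hxn : ‖x (Fin.last n)‖ = H) :
    ((n : ℝ) / ((n : ℝ) + 1) ^ 2) * (H - M) ^ 2 ≤
      projVar x (‖x (Fin.last n)‖⁻¹ • x (Fin.last n)) := by
  have hH : 0 < H := lt_of_lt_of_le hM hHM
  have key : ∀ y : Fin (n + 1) → ℝ, (∀ i : Fin n, y i.castSucc ≤ M) → y (Fin.last n) = H →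
      ((n : ℝ) / ((n : ℝ) + 1) ^ 2) * (H - M) ^ 2 ≤ sampleVar y := by
    intro y hy hl
    unfold sampleVar
    rcases Nat.eq_zero_or_pos n with h0 | hn
    · subst h0
      simp
    have hn' : (0 : ℝ) < n := by exact_mod_cast hn
    set m : ℝ := (∑ j, y j) / ((n + 1 : ℕ) : ℝ) with hm
    have hsum : ∑ j, y j = ∑ i : Fin n, y i.castSucc + H := by
      rw [Fin.sum_univ_castSucc, hl]
    have hmN : m * (n + 1) = ∑ i : Fin n, y i.castSucc + H := by
      rw [hm, hsum]
      push_cast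
      field_simp
    have hS : ∑ i : Fin n, y i.castSucc ≤ n * M := by
      calc ∑ i : Fin n, y i.castSucc ≤ ∑ i : Fin n, M := Finset.sum_le_sum fun i _ => hy i
        _ = n * M := by simp
    have hdev : ∑ i : Fin n, (y i.castSucc - m) = -(H - m) := by
      rw [Finset.sum_sub_distrib]
      simp
      linarith
    have hcs := sq_sum_le_card_mul_sum_sq (s := (Finset.univ : Finset (Fin n)))
      (f := fun i => y i.castSucc - m)
    simp only [hdev, Finset.card_univ, Fintype.card_fin, neg_sq] at hcs
    have hd : n * (H - M) ≤ (H - m) * (n + 1) := by nlinarith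
    have hd2 : (n * (H - M)) ^ 2 ≤ ((H - m) * (n + 1)) ^ 2 :=
      pow_le_pow_left₀ (mul_nonneg hn'.le (by linarith)) hd 2
    rw [Fin.sum_univ_castSucc, hl]
    set Q := ∑ i : Fin n, (y i.castSucc - m) ^ 2
    push_cast
    rw [div_mul_eq_mul_div, div_le_div_iff₀ (by positivity) (by positivity)]
    have h1 : (n : ℝ) * (H - M) ^ 2 ≤ (Q + (H - m) ^ 2) * (n + 1) := by
      refine le_of_mul_le_mul_left ?_ hn'
      nlinarith [mul_le_mul_of_nonneg_right hcs (by positivity : (0 : ℝ) ≤ n + 1)]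
    nlinarith [mul_le_mul_of_nonneg_right h1 (by positivity : (0 : ℝ) ≤ n + 1)]
  unfold projVar
  apply key
  · intro i
    refine (real_inner_le_norm _ _).trans ?_
    have : ‖‖x (Fin.last n)‖⁻¹ • x (Fin.last n)‖ = 1 := by
      rw [norm_smul, norm_inv, norm_norm, hxn]
      exact inv_mul_cancel₀ hH.ne'
    rw [this, mul_one]
    exact hx i
  · simp only [inner_smul_right, real_inner_self_eq_norm_sq, hxn]
    field_simp
end

section
/- Let x_1, …, x_{n+1} ∈ ℝ^p with ‖x_i‖ ≤ M for i = 1, …, n and ‖x_{n+1}‖ = H, where M > 0 and H > (n+2)M. Let u be a leading principal component direction of x_1, …, x_{n+1}. Then for every unit vector w ∈ ℝ^p orthogonal to u, the projected sample variance satisfies s_w²(x) ≤ (M/(n+1)) (nM + 4(H − M)). -/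
open scoped RealInnerProductSpace

theorem sampleVar_le_aux {m : ℕ} (hm : 0 < m) (y : Fin m → ℝ) :
    sampleVar y ≤ (∑ i, (y i) ^ 2) / m := by
  unfold sampleVar
  have hm' : (0 : ℝ) < m := by exact_mod_cast hm
  apply div_le_div_of_nonneg_right _ hm'.le
  set S := ∑ j, y j with hS
  have h1 : ∑ i, (y i - S / m) ^ 2 = ∑ i, (y i) ^ 2 - S ^ 2 / m := by
    have : ∀ i, (y i - S / m) ^ 2 = (y i) ^ 2 - 2 * (S / m) * y i + (S / m) ^ 2 := by
      intro i; ring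
    simp only [this, Finset.sum_add_distrib, Finset.sum_sub_distrib, ← Finset.mul_sum, ← hS]
    simp
    field_simp
    ring
  rw [h1]
  have : 0 ≤ S ^ 2 / m := by positivity
  linarith

theorem sampleVar_rot_aux {m : ℕ} (y z : Fin m → ℝ) (c s : ℝ) (h : c ^ 2 + s ^ 2 = 1) :
    sampleVar (fun i => c * y i + s * z i) + sampleVar (fun i => -s * y i + c * z i)
      = sampleVar y + sampleVar z := by
  unfold sampleVar
  simp only [Finset.sum_add_distrib, ← Finset.mul_sum]
  rw [← add_div, ← add_div, ← Finset.sum_add_distrib, ← Finset.sum_add_distrib]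
  congr 1
  apply Finset.sum_congr rfl
  intro i _
  generalize (∑ j, y j) = A
  generalize (∑ j, z j) = B
  have : ∀ P Q : ℝ, (c * P + s * Q) ^ 2 + (-s * P + c * Q) ^ 2 = P ^ 2 + Q ^ 2 := by
    intro P Q
    linear_combination (P ^ 2 + Q ^ 2) * h
  rw [← this (y i - A / m) (z i - B / m)]
  ring

theorem exists_rot_aux (a b : ℝ) : ∃ c s : ℝ, c ^ 2 + s ^ 2 = 1 ∧ -s * a + c * b = 0 := by
  by_cases h : a ^ 2 + b ^ 2 = 0
  · have hb : b = 0 := by nlinarith [sq_nonneg a, sq_nonneg b]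
    exact ⟨1, 0, by norm_num, by simp [hb]⟩
  · have hp : 0 < a ^ 2 + b ^ 2 := lt_of_le_of_ne (by positivity) (Ne.symm h)
    refine ⟨a / √(a ^ 2 + b ^ 2), b / √(a ^ 2 + b ^ 2), ?_, by ring⟩
    rw [div_pow, div_pow, Real.sq_sqrt hp.le, ← add_div, div_self h]

theorem norm_rot_aux {p : ℕ} (u w : EuclideanSpace ℝ (Fin p)) (hu : ‖u‖ = 1) (hw : ‖w‖ = 1)
    (huw : ⟪u, w⟫ = 0) (c s : ℝ) (h : c ^ 2 + s ^ 2 = 1) : ‖c • u + s • w‖ = 1 := by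
  have h2 : ‖c • u + s • w‖ ^ 2 = 1 := by
    rw [norm_add_sq_real, norm_smul, norm_smul, hu, hw, inner_smul_left, inner_smul_right, huw]
    simpa using h
  nlinarith [norm_nonneg (c • u + s • w)]

/-- Let `x₁, …, x_{n+1} ∈ ℝᵖ` with `‖xᵢ‖ ≤ M` for `i ≤ n` and `‖x_{n+1}‖ = H`, where
`M > 0` and `H > (n+2)M`. Let `u` be a leading principal component direction of
`x₁, …, x_{n+1}`. Then for every unit vector `w ∈ ℝᵖ` orthogonal to `u`, the projected
sample variance satisfies `s_w²(x) ≤ (M/(n+1))(nM + 4(H − M))`. -/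
theorem projVar_orthogonal_to_leading_pc_le (n p : ℕ) (M H : ℝ) (hM : 0 < M)
    (hH : ((n : ℝ) + 2) * M < H)
    (x : Fin (n + 1) → EuclideanSpace ℝ (Fin p))
    (hx : ∀ i : Fin n, ‖x i.castSucc‖ ≤ M) (hxn : ‖x (Fin.last n)‖ = H)
    (u : EuclideanSpace ℝ (Fin p)) (hu : ‖u‖ = 1)
    (hlead : ∀ w : EuclideanSpace ℝ (Fin p), ‖w‖ = 1 → projVar x w ≤ projVar x u)
    (w : EuclideanSpace ℝ (Fin p)) (hw : ‖w‖ = 1) (huw : ⟪u, w⟫ = 0) :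
    projVar x w ≤ (M / ((n : ℝ) + 1)) * ((n : ℝ) * M + 4 * (H - M)) := by
  obtain ⟨c, s, hcs, h0⟩ := exists_rot_aux ⟪x (Fin.last n), u⟫ ⟪x (Fin.last n), w⟫
  have hrot := sampleVar_rot_aux (fun i => ⟪x i, u⟫) (fun i => ⟪x i, w⟫) c s hcs
  have e1 : projVar x (c • u + s • w) = sampleVar (fun i => c * ⟪x i, u⟫ + s * ⟪x i, w⟫) := by
    simp only [projVar, inner_add_right, inner_smul_right]
  have e2 : projVar x (-s • u + c • w)
      = sampleVar (fun i => -s * ⟪x i, u⟫ + c * ⟪x i, w⟫) := by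
    simp only [projVar, inner_add_right, inner_smul_right]
  have l1 := hlead _ (norm_rot_aux u w hu hw huw c s hcs)
  have hv : ‖-s • u + c • w‖ = 1 :=
    norm_rot_aux u w hu hw huw (-s) c (by linear_combination hcs)
  have hx0 : ⟪x (Fin.last n), -s • u + c • w⟫ = 0 := by
    rw [inner_add_right, inner_smul_right, inner_smul_right]; exact h0
  have key : projVar x w ≤ projVar x (-s • u + c • w) := by
    rw [← e1, ← e2] at hrot
    change _ = projVar x u + projVar x w at hrot
    linarith
  refine key.trans ?_
  generalize -s • u + c • w = v at hv hx0
  refine (sampleVar_le_aux (Nat.succ_pos n) _).trans ?_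
  rw [Fin.sum_univ_castSucc, hx0]
  have hs : ∑ i : Fin n, ⟪x i.castSucc, v⟫ ^ 2 ≤ n * M ^ 2 := by
    have : ∀ i ∈ (Finset.univ : Finset (Fin n)), ⟪x i.castSucc, v⟫ ^ 2 ≤ M ^ 2 := by
      intro i _
      apply sq_le_sq'
      · have := neg_le_of_abs_le (abs_real_inner_le_norm (x i.castSucc) v)
        rw [hv] at this
        linarith [hx i]
      · have := real_inner_le_norm (x i.castSucc) v
        rw [hv] at this
        linarith [hx i]
    simpa using Finset.sum_le_sum this
  have hn : (0 : ℝ) ≤ n := Nat.cast_nonneg n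
  have hHM : 0 ≤ H - M := by nlinarith
  push_cast
  rw [div_mul_eq_mul_div]
  apply div_le_div_of_nonneg_right _ (by positivity)
  nlinarith [mul_nonneg hM.le hHM]
end

section
/- Let x_1, …, x_{n+1} ∈ ℝ^p with ‖x_i‖ ≤ M for i = 1, …, n and ‖x_{n+1}‖ = H, where M > 0, H > (n+2)M, and p ≥ 2, n ≥ 4. Let x̄ = (1/(n+1)) Σ_{i=1}^{n+1} x_i, and let X − 1_{n+1} x̄′ ∈ ℝ^{(n+1)×p} be the centered data matrix whose i-th row is (x_i − x̄)′. Suppose X − 1_{n+1} x̄′ = U D V′ is a singular value decomposition: U ∈ ℝ^{(n+1)×p} has orthonormal columns, D = diag(d_1, …, d_p) with d_1 ≥ d_2 ≥ ⋯ ≥ d_p ≥ 0, and V ∈ ℝ^{p×p} is orthogonal. Let σ_1, …, σ_p be arbitrary permutations of {1, …, n+1}, let U* ∈ ℝ^{(n+1)×p} be defined by U*_{i,j} = U_{σ_j(i),j}, and let the anonymized data be X* = U* D V′ + 1_{n+1} x̄′, with rows (x_i*)′. Then min_{i = 1, …, n+1} ‖x_{n+1} − x_i*‖² ≤ 2(p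 − 1) M {(n − 4)M + 4H}. -/
open Matrix

lemma aux_iso {m k : ℕ} (A : Matrix (Fin m) (Fin k) ℝ) (hA : Aᵀ * A = 1) (w : Fin k → ℝ) :
    ∑ i, (∑ j, A i j * w j) ^ 2 = ∑ j, w j ^ 2 := by
  have h1 : (A *ᵥ w) ⬝ᵥ (A *ᵥ w) = w ⬝ᵥ w := by
    rw [Matrix.dotProduct_mulVec, Matrix.vecMul_mulVec, hA, Matrix.vecMul_one]
  simpa [dotProduct, Matrix.mulVec, pow_two] using h1

lemma aux_col {m k : ℕ} (A : Matrix (Fin m) (Fin k) ℝ) (hA : Aᵀ * A = 1) (j : Fin k) :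
    ∑ i, A i j ^ 2 = 1 := by
  have := congrFun (congrFun hA j) j
  simpa [Matrix.mul_apply, pow_two] using this

lemma aux_diff {m k : ℕ} (A : Matrix (Fin m) (Fin k) ℝ) (hA : Aᵀ * A = 1) (j : Fin k)
    (a b : Fin m) : (A a j - A b j) ^ 2 ≤ 2 := by
  by_cases hab : a = b
  · subst hab; simp
  · have h := aux_col A hA j
    have h2 : ∑ i ∈ ({a, b} : Finset (Fin m)), A i j ^ 2 ≤ ∑ i, A i j ^ 2 :=
      Finset.sum_le_sum_of_subset_of_nonneg (Finset.subset_univ _) (fun _ _ _ => sq_nonneg _)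
    rw [Finset.sum_pair hab, h] at h2
    nlinarith [sq_nonneg (A a j + A b j)]

lemma aux_center {E : Type*} [NormedAddCommGroup E] [InnerProductSpace ℝ E] (n : ℕ)
    (x : Fin (n + 1) → E) (xbar : E) (hxbar : ∑ i, x i = ((n : ℝ) + 1) • xbar) :
    ∑ i, ‖x i - xbar‖ ^ 2 = ∑ i, ‖x i‖ ^ 2 - ((n : ℝ) + 1) * ‖xbar‖ ^ 2 := by
  have h : ∑ i, inner ℝ (x i) xbar = ((n : ℝ) + 1) * ‖xbar‖ ^ 2 := by
    rw [← sum_inner, hxbar, real_inner_smul_left, real_inner_self_eq_norm_sq]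
  simp only [norm_sub_sq_real, Finset.sum_add_distrib, Finset.sum_sub_distrib, ← Finset.mul_sum, h]
  simp
  ring

/-- **Spectral anonymization cannot mask a strong outlier.**
Let `x₁, …, x_{n+1} ∈ ℝᵖ` with `‖xᵢ‖ ≤ M` for `i ≤ n` and `‖x_{n+1}‖ = H`, where
`M > 0`, `H > (n+2)M`, `p ≥ 2` and `n ≥ 4`. Let `x̄` be the sample mean, let
`X − 1_{n+1} x̄' = U D V'` be a singular value decomposition of the centered data matrix
(`U` with orthonormal columns, `D = diag d` with `d₁ ≥ ⋯ ≥ d_p ≥ 0`, `V` orthogonal),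
let `σ₁, …, σ_p` be arbitrary permutations of the rows, `U*_{i,j} = U_{σ_j(i),j}`, and
let the spectrally anonymized data be `X* = U* D V' + 1_{n+1} x̄'` with rows `xᵢ*`.
Then `min_{i} ‖x_{n+1} − xᵢ*‖² ≤ 2(p − 1) M {(n − 4)M + 4H}`. -/
theorem spectral_anonymization_replicates_outlier (n p : ℕ) (hn : 4 ≤ n) (hp : 2 ≤ p)
    (M H : ℝ) (hM : 0 < M) (hH : ((n : ℝ) + 2) * M < H)
    (x : Fin (n + 1) → EuclideanSpace ℝ (Fin p))
    (hx : ∀ i : Fin n, ‖x i.castSucc‖ ≤ M) (hxn : ‖x (Fin.last n)‖ = H)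
    (xbar : EuclideanSpace ℝ (Fin p)) (hxbar : xbar = (((n : ℝ) + 1)⁻¹) • (∑ i, x i))
    (U : Matrix (Fin (n + 1)) (Fin p) ℝ) (hU : Uᵀ * U = 1)
    (d : Fin p → ℝ) (hd : ∀ j k : Fin p, j ≤ k → d k ≤ d j) (hd0 : ∀ j, 0 ≤ d j)
    (V : Matrix (Fin p) (Fin p) ℝ) (hV : Vᵀ * V = 1)
    (hSVD : ∀ (i : Fin (n + 1)) (j : Fin p),
      x i j - xbar j = (U * Matrix.diagonal d * Vᵀ) i j)
    (σ : Fin p → Equiv.Perm (Fin (n + 1)))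
    (Ustar : Matrix (Fin (n + 1)) (Fin p) ℝ)
    (hUstar : ∀ (i : Fin (n + 1)) (j : Fin p), Ustar i j = U (σ j i) j)
    (xstar : Fin (n + 1) → EuclideanSpace ℝ (Fin p))
    (hxstar : ∀ (i : Fin (n + 1)) (j : Fin p),
      xstar i j = (Ustar * Matrix.diagonal d * Vᵀ) i j + xbar j) :
    ∃ i : Fin (n + 1),
      ‖x (Fin.last n) - xstar i‖ ^ 2 ≤
        2 * ((p : ℝ) - 1) * M * (((n : ℝ) - 4) * M + 4 * H) := by
  have hp0 : 0 < p := by omega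
  let z : Fin p := ⟨0, hp0⟩
  set v := x (Fin.last n) with hv
  have hn' : (4 : ℝ) ≤ n := by exact_mod_cast hn
  have hp' : (2 : ℝ) ≤ p := by exact_mod_cast hp
  have hHM : M < H := by nlinarith
  have hH0 : 0 < H := by linarith
  have hVV : Vᵀᵀ * Vᵀ = 1 := by
    rw [Matrix.transpose_transpose]; exact mul_eq_one_comm.mp hV
  have hsum : ∑ i, x i = ((n : ℝ) + 1) • xbar := by
    rw [hxbar, smul_smul, mul_inv_cancel₀ (by positivity), one_smul]
  -- rows
  have hrow : ∀ i j, (x i - xbar) j = ∑ k, V j k * (U i k * d k) := by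
    intro i j
    rw [PiLp.sub_apply, hSVD, Matrix.mul_apply]
    refine Finset.sum_congr rfl fun k _ => ?_
    rw [Matrix.mul_diagonal, Matrix.transpose_apply]; ring
  have htot : ∑ i, ‖x i - xbar‖ ^ 2 = ∑ k, d k ^ 2 := by
    have : ∀ i, ‖x i - xbar‖ ^ 2 = ∑ k, U i k ^ 2 * d k ^ 2 := by
      intro i
      rw [EuclideanSpace.real_norm_sq_eq]
      simp only [hrow, aux_iso V hV, mul_pow]
    simp only [this]
    rw [Finset.sum_comm]
    refine Finset.sum_congr rfl fun k _ => ?_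
    rw [← Finset.sum_mul, aux_col U hU, one_mul]
  let c : Fin p → ℝ := fun k => ∑ j, Vᵀ k j * v j
  have hc : ∑ k, c k ^ 2 = H ^ 2 := by
    rw [aux_iso Vᵀ hVV, ← EuclideanSpace.real_norm_sq_eq, hxn]
  have hinn : ∀ i, inner ℝ (x i - xbar) v = ∑ k, U i k * (d k * c k) := by
    intro i
    rw [PiLp.inner_apply]
    simp only [hrow, RCLike.inner_apply, conj_trivial, Finset.mul_sum, c]
    rw [Finset.sum_comm]
    refine Finset.sum_congr rfl fun k _ => Finset.sum_congr rfl fun j _ => ?_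
    rw [Matrix.transpose_apply]; ring
  have hd1 : ∑ i, (inner ℝ (x i - xbar) v) ^ 2 ≤ d z ^ 2 * H ^ 2 := by
    simp only [hinn]
    rw [aux_iso U hU, ← hc, Finset.mul_sum]
    refine Finset.sum_le_sum fun k _ => ?_
    rw [mul_pow]
    have : d k ≤ d z := hd z k (Fin.mk_le_of_le_val (Nat.zero_le _))
    have := hd0 k
    gcongr
  have hc1 := aux_center n x xbar hsum
  have hc2 := aux_center n (fun i => (inner ℝ (x i) v : ℝ)) (inner ℝ xbar v)
    (by rw [← sum_inner, hsum, real_inner_smul_left, smul_eq_mul])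
  simp only [← inner_sub_left, Real.norm_eq_abs, sq_abs] at hc2
  have hcs : (inner ℝ xbar v : ℝ) ^ 2 ≤ ‖xbar‖ ^ 2 * H ^ 2 := by
    rw [← hxn, ← mul_pow, ← sq_abs]
    have := abs_real_inner_le_norm xbar v
    gcongr
  have hres : (∑ i, ‖x i‖ ^ 2) * H ^ 2 - ∑ i, (inner ℝ (x i) v : ℝ) ^ 2 ≤ n * M ^ 2 * H ^ 2 := by
    rw [Fin.sum_univ_castSucc, Fin.sum_univ_castSucc, ← hv, real_inner_self_eq_norm_sq, hxn]
    have h1 : ∑ i : Fin n, ‖x i.castSucc‖ ^ 2 ≤ ∑ i : Fin n, M ^ 2 :=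
      Finset.sum_le_sum fun i _ => by have := hx i; gcongr
    have h2 : 0 ≤ ∑ i : Fin n, (inner ℝ (x i.castSucc) v : ℝ) ^ 2 :=
      Finset.sum_nonneg fun i _ => sq_nonneg _
    simp at h1
    nlinarith [mul_le_mul_of_nonneg_right h1 (sq_nonneg H)]
  have hmain : ∑ k, d k ^ 2 - d z ^ 2 ≤ n * M ^ 2 := by
    have hpos : 0 < H ^ 2 := by positivity
    refine le_of_mul_le_mul_right ?_ hpos
    have h3 := mul_le_mul_of_nonneg_left hcs (by positivity : (0 : ℝ) ≤ (n : ℝ) + 1)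
    rw [← htot, hc1]
    rw [hc2] at hd1
    linarith
  refine ⟨(σ z).symm (Fin.last n), ?_⟩
  set i0 := (σ z).symm (Fin.last n) with hi0
  have hdiff : ∀ j, (v - xstar i0) j =
      ∑ k, V j k * ((U (Fin.last n) k - U (σ k i0) k) * d k) := by
    intro j
    have h1 := hrow (Fin.last n) j
    rw [PiLp.sub_apply] at h1 ⊢
    rw [hxstar, Matrix.mul_apply]
    have h2 : v j = xbar j + ∑ k, V j k * (U (Fin.last n) k * d k) := by
      rw [← h1]; ring
    rw [h2, add_comm _ (xbar j), add_sub_add_left_eq_sub, ← Finset.sum_sub_distrib]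
    refine Finset.sum_congr rfl fun k _ => ?_
    rw [Matrix.mul_diagonal, Matrix.transpose_apply, hUstar]; ring
  have hb : ‖v - xstar i0‖ ^ 2 ≤ 2 * (∑ k, d k ^ 2 - d z ^ 2) := by
    rw [EuclideanSpace.real_norm_sq_eq]
    simp only [hdiff, aux_iso V hV]
    rw [← Finset.add_sum_erase _ _ (Finset.mem_univ z),
      ← Finset.add_sum_erase _ (fun k => d k ^ 2) (Finset.mem_univ z)]
    have h0 : σ z i0 = Fin.last n := by simp [hi0]
    rw [h0, add_sub_cancel_left, Finset.mul_sum]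
    simp only [sub_self, zero_mul, ne_eq, OfNat.ofNat_ne_zero, not_false_eq_true, zero_pow, zero_add]
    refine Finset.sum_le_sum fun k _ => ?_
    rw [mul_pow]
    have := aux_diff U hU k (Fin.last n) (σ k i0)
    gcongr
  have hB : n * M ^ 2 ≤ M * (((n : ℝ) - 4) * M + 4 * H) := by nlinarith
  have hB0 : 0 ≤ n * M ^ 2 := by positivity
  have hB2 : 0 ≤ ((p : ℝ) - 2) * (M * (((n : ℝ) - 4) * M + 4 * H)) :=
    mul_nonneg (by linarith) (by linarith)
  linarith
end
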